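/- arXiv:1110.0699 — 2 statements merged into one kernel-verified Lean document; each statement's English description precedes it below -/
import Mathlib

section
/- Let α be a continuous action of a countable sofic group G on a compact metrizable space X with sofic approximation sequence Σ, let f : X → ℝ be continuous, and let ρ be a dynamically generating continuous pseudometric on X with respect to which f is continuous. Enumerate the elements of G as s_1 = e, s_2, s_3, … and define ρ'(x,y) = Σ_{n=1}^∞ 2^{−n} ρ(s_n x, s_n y) for x,y ∈ X. Then ρ' is a compatible metric on X (a metric inducing the topology of X), and P_{Σ,∞}(f,X,G,ρ) = P_{Σ,∞}(f,X,G,ρ'). -/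
open Filter MeasureTheory
open scoped Pointwise Classical BigOperators

namespace Sofic

structure ContAction (G : Type*) [Group G] (X : Type*) [TopologicalSpace X]
    (α : G → X → X) : Prop where
  one : ∀ x, α 1 x = x
  mul : ∀ s t x, α (s * t) x = α s (α t x)
  cont : ∀ s, Continuous (α s)

structure IsContPseudoMetric (X : Type*) [TopologicalSpace X] (ρ : X → X → ℝ) : Prop where
  nonneg : ∀ x y, 0 ≤ ρ x y
  refl : ∀ x, ρ x x = 0
  symm : ∀ x y, ρ x y = ρ y x
  triangle : ∀ x y z, ρ x z ≤ ρ x y + ρ y z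
  cont : Continuous fun p : X × X => ρ p.1 p.2

structure IsCompatMetric (X : Type*) [TopologicalSpace X] (ρ : X → X → ℝ)
    extends IsContPseudoMetric X ρ : Prop where
  eq_of_zero : ∀ x y, ρ x y = 0 → x = y
  ball_mem : ∀ x : X, ∀ U ∈ nhds x, ∃ ε > 0, {y | ρ x y < ε} ⊆ U

structure IsSoficApprox (G : Type*) [Group G] (d : ℕ → ℕ)
    (σ : ∀ i, G → Equiv.Perm (Fin (d i))) : Prop where
  mul : ∀ s t : G, Tendsto
    (fun i => ((Finset.univ.filter fun a : Fin (d i) => σ i s (σ i t a) = σ i (s * t) a).card : ℝ) / (d i : ℝ))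
    atTop (nhds 1)
  sep : ∀ s t : G, s ≠ t → Tendsto
    (fun i => ((Finset.univ.filter fun a : Fin (d i) => σ i s a ≠ σ i t a).card : ℝ) / (d i : ℝ))
    atTop (nhds 1)
  dim_top : Tendsto d atTop atTop

noncomputable def rho2 {X : Type*} (ρ : X → X → ℝ) {d : ℕ} (φ ψ : Fin d → X) : ℝ :=
  Real.sqrt ((1 / (d : ℝ)) * ∑ a, (ρ (φ a) (ψ a)) ^ 2)

noncomputable def rhoInf {X : Type*} (ρ : X → X → ℝ) {d : ℕ} (φ ψ : Fin d → X) : ℝ :=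
  ⨆ a : Fin d, ρ (φ a) (ψ a)

def MapSet {G X : Type*} [Group G] (α : G → X → X) (ρ : X → X → ℝ)
    (F : Finset G) (δ : ℝ) {d : ℕ} (σ : G → Equiv.Perm (Fin d)) : Set (Fin d → X) :=
  {φ | ∀ s ∈ F, rho2 ρ (fun a => α s (φ a)) (fun a => φ (σ s a)) < δ}

noncomputable def Mval {G X : Type*} [Group G] (α : G → X → X) (f : X → ℝ) (ρ : X → X → ℝ)
    (ε : ℝ) (F : Finset G) (δ : ℝ) {d : ℕ} (σ : G → Equiv.Perm (Fin d))
    (sepd : (Fin d → X) → (Fin d → X) → ℝ) : ℝ :=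
  sSup {r : ℝ | ∃ E : Finset (Fin d → X), ↑E ⊆ MapSet α ρ F δ σ ∧
    (∀ φ ∈ E, ∀ ψ ∈ E, φ ≠ ψ → ε ≤ sepd φ ψ) ∧
    r = ∑ φ ∈ E, Real.exp (∑ a, f (φ a))}

noncomputable def PressureInf {G X : Type*} [Group G] (α : G → X → X) (f : X → ℝ)
    (ρ : X → X → ℝ) (d : ℕ → ℕ) (σ : ∀ i, G → Equiv.Perm (Fin (d i))) : EReal :=
  ⨆ (ε : ℝ) (_ : 0 < ε), ⨅ (F : Finset G) (_ : F.Nonempty), ⨅ (δ : ℝ) (_ : 0 < δ),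
    Filter.limsup (fun i =>
      if (MapSet α ρ F δ (σ i)).Nonempty then
        (((Real.log (Mval α f ρ ε F δ (σ i) (rhoInf ρ))) / (d i : ℝ) : ℝ) : EReal)
      else (⊥ : EReal)) atTop

noncomputable def Pressure2 {G X : Type*} [Group G] (α : G → X → X) (f : X → ℝ)
    (ρ : X → X → ℝ) (d : ℕ → ℕ) (σ : ∀ i, G → Equiv.Perm (Fin (d i))) : EReal :=
  ⨆ (ε : ℝ) (_ : 0 < ε), ⨅ (F : Finset G) (_ : F.Nonempty), ⨅ (δ : ℝ) (_ : 0 < δ),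
    Filter.limsup (fun i =>
      if (MapSet α ρ F δ (σ i)).Nonempty then
        (((Real.log (Mval α f ρ ε F δ (σ i) (rho2 ρ))) / (d i : ℝ) : ℝ) : EReal)
      else (⊥ : EReal)) atTop

def MapMuSet {G X : Type*} [Group G] [TopologicalSpace X] [MeasurableSpace X]
    (α : G → X → X) (μ : Measure X) (ρ : X → X → ℝ) (F : Finset G)
    (L : Finset C(X, ℝ)) (δ : ℝ) {d : ℕ} (σ : G → Equiv.Perm (Fin d)) : Set (Fin d → X) :=
  {φ | φ ∈ MapSet α ρ F δ σ ∧
    ∀ g ∈ L, |(1 / (d : ℝ)) * ∑ j, g (φ j) - ∫ x, g x ∂μ| < δ}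

noncomputable def Nval {X : Type*} (ε : ℝ) {d : ℕ} (Y : Set (Fin d → X))
    (sepd : (Fin d → X) → (Fin d → X) → ℝ) : ℝ :=
  sSup {r : ℝ | ∃ E : Finset (Fin d → X), ↑E ⊆ Y ∧
    (∀ φ ∈ E, ∀ ψ ∈ E, φ ≠ ψ → ε ≤ sepd φ ψ) ∧ r = (E.card : ℝ)}

noncomputable def MeasEntropy {G X : Type*} [Group G] [TopologicalSpace X] [MeasurableSpace X]
    (α : G → X → X) (μ : Measure X) (ρ : X → X → ℝ) (d : ℕ → ℕ)
    (σ : ∀ i, G → Equiv.Perm (Fin (d i))) : EReal :=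
  ⨆ (ε : ℝ) (_ : 0 < ε), ⨅ (F : Finset G) (_ : F.Nonempty),
    ⨅ (L : Finset C(X, ℝ)) (_ : L.Nonempty), ⨅ (δ : ℝ) (_ : 0 < δ),
      Filter.limsup (fun i =>
        if (MapMuSet α μ ρ F L δ (σ i)).Nonempty then
          (((Real.log (Nval ε (MapMuSet α μ ρ F L δ (σ i)) (rhoInf ρ))) / (d i : ℝ) : ℝ) : EReal)
        else (⊥ : EReal)) atTop

def IsInvProb {G X : Type*} [Group G] [MeasurableSpace X]
    (α : G → X → X) (μ : Measure X) : Prop :=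
  IsProbabilityMeasure μ ∧ ∀ s : G, Measure.map (α s) μ = μ

noncomputable def Kval {G X : Type*} [Group G] (α : G → X → X) (f : X → ℝ)
    (ρ : X → X → ℝ) (ε : ℝ) (F : Finset G) : ℝ :=
  sSup {r : ℝ | ∃ D : Finset X,
    (∀ x ∈ D, ∀ y ∈ D, x ≠ y → ε ≤ ⨆ s ∈ F, ρ (α s x) (α s y)) ∧
    r = ∑ x ∈ D, Real.exp (∑ s ∈ F, f (α s x))}

def IsFolnerSeq (G : Type*) [Group G] [DecidableEq G] (Fol : ℕ → Finset G) : Prop :=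
  (∀ n, (Fol n).Nonempty) ∧ ∀ s : G,
    Tendsto (fun n =>
      (((((Fol n).image fun t => s * t) \ Fol n) ∪ (Fol n \ ((Fol n).image fun t => s * t))).card : ℝ)
        / ((Fol n).card : ℝ)) atTop (nhds 0)

/-- The term whose upper limit along the sofic approximation defines `PressureInf`. -/
noncomputable def pressureTerm {G X : Type*} [Group G] (α : G → X → X) (f : X → ℝ)
    (ρ : X → X → ℝ) (ε : ℝ) (F : Finset G) (δ : ℝ) {d : ℕ} (σ : G → Equiv.Perm (Fin d)) : EReal :=
  if (MapSet α ρ F δ σ).Nonempty then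
    (((Real.log (Mval α f ρ ε F δ σ (rhoInf ρ))) / (d : ℝ) : ℝ) : EReal)
  else (⊥ : EReal)

/-- The average of the translates of `ρ` along the sequence `s`, with weights `2⁻¹, 2⁻², …`. -/
noncomputable def orbitMetric {G X : Type*} (α : G → X → X) (ρ : X → X → ℝ) (s : ℕ → G)
    (x y : X) : ℝ :=
  ∑' n : ℕ, (1 / 2 : ℝ) ^ (n + 1) * ρ (α (s n) x) (α (s n) y)

section PseudoMetric

variable {X : Type*} [TopologicalSpace X] [CompactSpace X] {ρ : X → X → ℝ}

lemma IsContPseudoMetric.exists_bound (hρ : IsContPseudoMetric X ρ) :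
    ∃ C > 0, ∀ x y, ρ x y ≤ C := by
  obtain ⟨C, hC⟩ := isCompact_univ.exists_bound_of_continuousOn hρ.cont.continuousOn
  refine ⟨max C 1, by positivity, fun x y => ?_⟩
  exact (le_abs_self _).trans ((hC (x, y) trivial).trans (le_max_left _ _))

lemma IsContPseudoMetric.exists_finite_partition (hρ : IsContPseudoMetric X ρ) {ε : ℝ}
    (hε : 0 < ε) : ∃ (t : Finset X) (c : X → t), ∀ x y, c x = c y → ρ x y < ε := by
  obtain ⟨t, ht⟩ := isCompact_univ.elim_finite_subcover (fun x : X => {y | ρ x y < ε / 2})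
    (fun x => isOpen_lt (hρ.cont.comp (by fun_prop : Continuous fun y : X => (x, y)))
      continuous_const)
    (fun x _ => Set.mem_iUnion.2 ⟨x, by simp [hρ.refl, hε]⟩)
  have h : ∀ x, ∃ z : t, ρ z x < ε / 2 := by
    intro x
    obtain ⟨z, hz, hzx⟩ := Set.mem_iUnion₂.1 (ht (Set.mem_univ x))
    exact ⟨⟨z, hz⟩, hzx⟩
  choose c hc using h
  refine ⟨t, c, fun x y hxy => ?_⟩
  have h₁ := hc x
  have h₂ := hc y
  rw [← hxy] at h₂
  have := hρ.triangle x (c x) y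
  rw [hρ.symm x (c x)] at this
  linarith

end PseudoMetric

section OrbitMetric

variable {G X : Type*} [TopologicalSpace X] [CompactSpace X]
  {α : G → X → X} {ρ : X → X → ℝ} {s : ℕ → G}

lemma summable_orbitMetric (hρ : IsContPseudoMetric X ρ) (α : G → X → X) (s : ℕ → G) (x y : X) :
    Summable fun n : ℕ => (1 / 2 : ℝ) ^ (n + 1) * ρ (α (s n) x) (α (s n) y) := by
  obtain ⟨C, -, hC⟩ := hρ.exists_bound
  refine Summable.of_nonneg_of_le (fun n => mul_nonneg (by positivity) (hρ.nonneg _ _))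
    (fun n => mul_le_mul_of_nonneg_left (hC _ _) (by positivity)) ?_
  exact ((summable_nat_add_iff 1).2 summable_geometric_two).mul_right C

lemma exists_orbitMetric_lt (hρ : IsContPseudoMetric X ρ) (α : G → X → X) (s : ℕ → G) {κ : ℝ}
    (hκ : 0 < κ) : ∃ N : ℕ, ∀ x y, (∀ n < N, ρ (α (s n) x) (α (s n) y) ≤ κ / 2) →
      orbitMetric α ρ s x y < κ := by
  obtain ⟨C, hC0, hC⟩ := hρ.exists_bound
  obtain ⟨N, hN⟩ := exists_pow_lt_of_lt_one (show 0 < κ / 2 / C by positivity)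
    (show (1 / 2 : ℝ) < 1 by norm_num)
  rw [lt_div_iff₀ hC0] at hN
  refine ⟨N, fun x y h => ?_⟩
  have hgeo : HasSum (fun n : ℕ => (1 / 2 : ℝ) ^ (n + 1)) 1 := by
    simpa [pow_succ] using hasSum_geometric_two.mul_right (1 / 2 : ℝ)
  have hsum := summable_orbitMetric hρ α s x y
  have hhead : ∑ n ∈ Finset.range N, (1 / 2 : ℝ) ^ (n + 1) * ρ (α (s n) x) (α (s n) y)
      ≤ κ / 2 := by
    calc _ ≤ ∑ n ∈ Finset.range N, (1 / 2 : ℝ) ^ (n + 1) * (κ / 2) :=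
          Finset.sum_le_sum fun n hn => mul_le_mul_of_nonneg_left
            (h n (Finset.mem_range.1 hn)) (by positivity)
      _ = (∑ n ∈ Finset.range N, (1 / 2 : ℝ) ^ (n + 1)) * (κ / 2) := by rw [Finset.sum_mul]
      _ ≤ 1 * (κ / 2) := by
          gcongr
          exact sum_le_hasSum _ (fun n _ => by positivity) hgeo
      _ = κ / 2 := one_mul _
  have htail : ∑' n : ℕ, (1 / 2 : ℝ) ^ (n + N + 1) * ρ (α (s (n + N)) x) (α (s (n + N)) y)
      ≤ (1 / 2 : ℝ) ^ N * C := by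
    refine hasSum_le (fun n => ?_) ((summable_nat_add_iff N).2 hsum).hasSum
      (by simpa only [mul_one] using hgeo.mul_left ((1 / 2 : ℝ) ^ N * C))
    calc _ ≤ (1 / 2 : ℝ) ^ (n + N + 1) * C :=
          mul_le_mul_of_nonneg_left (hC _ _) (by positivity)
      _ = _ := by ring
  unfold orbitMetric
  rw [← hsum.sum_add_tsum_nat_add N]
  linarith

variable [Group G]

lemma le_two_mul_orbitMetric (hρ : IsContPseudoMetric X ρ) (hα : ContAction G X α)
    (hs0 : s 0 = 1) (x y : X) : ρ x y ≤ 2 * orbitMetric α ρ s x y := by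
  have := (summable_orbitMetric hρ α s x y).le_tsum 0
    (fun n _ => mul_nonneg (by positivity) (hρ.nonneg _ _))
  simp only [hs0, hα.one] at this
  unfold orbitMetric
  linarith

lemma isContPseudoMetric_orbitMetric (hρ : IsContPseudoMetric X ρ) (hα : ContAction G X α) :
    IsContPseudoMetric X (orbitMetric α ρ s) where
  nonneg x y := tsum_nonneg fun n => mul_nonneg (by positivity) (hρ.nonneg _ _)
  refl x := by simp [orbitMetric, hρ.refl]
  symm x y := by simp only [orbitMetric, hρ.symm (α _ x)]
  triangle x y z := by
    have hxy := summable_orbitMetric hρ α s x y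
    have hyz := summable_orbitMetric hρ α s y z
    unfold orbitMetric
    rw [← hxy.tsum_add hyz]
    refine (summable_orbitMetric hρ α s x z).tsum_le_tsum (fun n => ?_) (hxy.add hyz)
    rw [← mul_add]
    exact mul_le_mul_of_nonneg_left (hρ.triangle _ _ _) (by positivity)
  cont := by
    obtain ⟨C, -, hC⟩ := hρ.exists_bound
    refine continuous_tsum (u := fun n => (1 / 2 : ℝ) ^ (n + 1) * C) (fun n => ?_)
      (((summable_nat_add_iff 1).2 summable_geometric_two).mul_right C) (fun n p => ?_)
    · exact continuous_const.mul (hρ.cont.comp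
        (((hα.cont _).comp continuous_fst).prodMk ((hα.cont _).comp continuous_snd)))
    · rw [Real.norm_of_nonneg (mul_nonneg (by positivity) (hρ.nonneg _ _))]
      exact mul_le_mul_of_nonneg_left (hC _ _) (by positivity)

lemma isCompatMetric_orbitMetric (hρ : IsContPseudoMetric X ρ) (hα : ContAction G X α)
    (hgen : ∀ x y : X, x ≠ y → ∃ g : G, 0 < ρ (α g x) (α g y))
    (hs : Function.Surjective s) : IsCompatMetric X (orbitMetric α ρ s) := by
  have hρ' := isContPseudoMetric_orbitMetric (s := s) hρ hα
  have hpos : ∀ x y, x ≠ y → 0 < orbitMetric α ρ s x y := by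
    intro x y hxy
    obtain ⟨g, hg⟩ := hgen x y hxy
    obtain ⟨n, rfl⟩ := hs g
    exact (summable_orbitMetric hρ α s x y).tsum_pos
      (fun n => mul_nonneg (by positivity) (hρ.nonneg _ _)) n (by positivity)
  refine ⟨hρ', fun x y h => ?_, fun x U hU => ?_⟩
  · by_contra hxy
    exact (hpos x y hxy).ne' h
  · have hc : IsCompact (interior U)ᶜ := isOpen_interior.isClosed_compl.isCompact
    have hcont : Continuous fun y => orbitMetric α ρ s x y :=
      hρ'.cont.comp (by fun_prop : Continuous fun y : X => (x, y))
    obtain h | hne := (interior U)ᶜ.eq_empty_or_nonempty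
    · refine ⟨1, one_pos, fun y _ => interior_subset ?_⟩
      rw [Set.compl_empty_iff] at h
      simp [h]
    · obtain ⟨z, hz, hmin⟩ := hc.exists_isMinOn hne hcont.continuousOn
      refine ⟨orbitMetric α ρ s x z, hpos _ _ ?_, fun y hy => ?_⟩
      · rintro rfl
        exact hz (mem_interior_iff_mem_nhds.2 hU)
      · by_contra hyU
        have hle : orbitMetric α ρ s x z ≤ orbitMetric α ρ s x y :=
          hmin fun h => hyU (interior_subset h)
        exact absurd hy (not_lt.2 hle)

end OrbitMetric

section Counting

variable {X : Type*} {ρ : X → X → ℝ} {d : ℕ}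

lemma card_mul_sq_le_of_rho2_lt {φ ψ : Fin d → X} {δ κ : ℝ} (hκ : 0 ≤ κ)
    (h : rho2 ρ φ ψ < δ) :
    ((Finset.univ.filter fun a => κ ≤ ρ (φ a) (ψ a)).card : ℝ) * κ ^ 2 ≤ δ ^ 2 * d := by
  obtain rfl | hd := Nat.eq_zero_or_pos d
  · simp
  have hd' : (0 : ℝ) < d := by exact_mod_cast hd
  have hδ : 0 < δ := (Real.sqrt_nonneg _).trans_lt h
  rw [rho2, Real.sqrt_lt' hδ, one_div, inv_mul_lt_iff₀ hd'] at h
  calc _ = ∑ a ∈ Finset.univ.filter (fun a => κ ≤ ρ (φ a) (ψ a)), κ ^ 2 := by simp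
    _ ≤ ∑ a ∈ Finset.univ.filter (fun a => κ ≤ ρ (φ a) (ψ a)), ρ (φ a) (ψ a) ^ 2 :=
        Finset.sum_le_sum fun a ha => by
          have := (Finset.mem_filter.1 ha).2
          gcongr
    _ ≤ ∑ a, ρ (φ a) (ψ a) ^ 2 :=
        Finset.sum_le_sum_of_subset_of_nonneg (Finset.filter_subset _ _)
          fun _ _ _ => sq_nonneg _
    _ ≤ _ := by linarith

lemma rho2_lt_of_card_le {φ ψ : Fin d → X} {δ κ η C : ℝ} (hd : 0 < d)
    (hnonneg : ∀ x y, 0 ≤ ρ x y) (hC : ∀ x y, ρ x y ≤ C) (hδ : 0 < δ)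
    (hcard : ((Finset.univ.filter fun a => κ ≤ ρ (φ a) (ψ a)).card : ℝ) ≤ η * d)
    (hsmall : κ ^ 2 + C ^ 2 * η < δ ^ 2) : rho2 ρ φ ψ < δ := by
  have hd' : (0 : ℝ) < d := by exact_mod_cast hd
  rw [rho2, Real.sqrt_lt' hδ, one_div, inv_mul_lt_iff₀ hd']
  calc ∑ a, ρ (φ a) (ψ a) ^ 2
      ≤ ∑ a, (κ ^ 2 + if κ ≤ ρ (φ a) (ψ a) then C ^ 2 else 0) := by
        refine Finset.sum_le_sum fun a _ => ?_
        have h0 := hnonneg (φ a) (ψ a)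
        split_ifs with h
        · have : ρ (φ a) (ψ a) ^ 2 ≤ C ^ 2 := by gcongr; exact hC _ _
          linarith [sq_nonneg κ]
        · have : ρ (φ a) (ψ a) ^ 2 ≤ κ ^ 2 := by gcongr; exact (not_le.1 h).le
          linarith
    _ = d * κ ^ 2 + (Finset.univ.filter fun a => κ ≤ ρ (φ a) (ψ a)).card * C ^ 2 := by
        simp [Finset.sum_add_distrib, Finset.sum_ite]
    _ ≤ d * κ ^ 2 + (η * d) * C ^ 2 := by gcongr
    _ = d * (κ ^ 2 + C ^ 2 * η) := by ring
    _ < d * δ ^ 2 := by gcongr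

/-- A finite set of words, most letters of which are blank, has small exponential growth rate. -/
lemma card_words_le {A : Type*} [Fintype A] {L η β : ℝ} (hL : 0 ≤ L)
    (hA : Fintype.card A * Real.exp (-L) ≤ β / 2) (hη : L * η ≤ β / 2)
    (S : Finset (Fin d → Option A))
    (hS : ∀ w ∈ S, ((Finset.univ.filter fun a => w a ≠ none).card : ℝ) ≤ η * d) :
    (S.card : ℝ) ≤ Real.exp (β * d) := by
  let v : Option A → ℝ := fun o => if o = none then 1 else Real.exp (-L)
  have hv : ∑ o, v o = 1 + Fintype.card A * Real.exp (-L) := by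
    simp [v, Fintype.sum_option]
  have hprod : ∀ w ∈ S, Real.exp (-(L * η * d)) ≤ ∏ a, v (w a) := by
    intro w hw
    have : ∏ a, v (w a) =
        Real.exp (-L) ^ (Finset.univ.filter fun a => w a ≠ none).card := by
      simp [v, Finset.prod_ite]
    rw [this, ← Real.exp_nat_mul, Real.exp_le_exp]
    nlinarith [mul_le_mul_of_nonneg_left (hS w hw) hL]
  have hsum : (S.card : ℝ) * Real.exp (-(L * η * d)) ≤ Real.exp (β / 2 * d) := by
    calc (S.card : ℝ) * Real.exp (-(L * η * d)) = ∑ w ∈ S, Real.exp (-(L * η * d)) := by simp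
      _ ≤ ∑ w ∈ S, ∏ a, v (w a) := Finset.sum_le_sum hprod
      _ ≤ ∑ w : Fin d → Option A, ∏ a, v (w a) :=
          Finset.sum_le_sum_of_subset_of_nonneg (Finset.subset_univ _) fun w _ _ =>
            Finset.prod_nonneg fun a _ => by dsimp only [v]; split_ifs <;> positivity
      _ = (∑ o, v o) ^ d := by
          have : ∏ _a : Fin d, ∑ o, v o = ∑ w : Fin d → Option A, ∏ a, v (w a) := by
            rw [Finset.prod_univ_sum, Fintype.piFinset_univ]
          rw [← this]
          simp
      _ ≤ Real.exp (β / 2) ^ d := by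
          rw [hv]
          gcongr
          linarith [Real.add_one_le_exp (β / 2)]
      _ = Real.exp (β / 2 * d) := by rw [← Real.exp_nat_mul, mul_comm]
  calc (S.card : ℝ) = S.card * Real.exp (-(L * η * d)) * Real.exp (L * η * d) := by
        rw [mul_assoc, ← Real.exp_add]; simp
    _ ≤ Real.exp (β / 2 * d) * Real.exp (β / 2 * d) := by gcongr
    _ = Real.exp (β * d) := by rw [← Real.exp_add]; ring_nf

end Counting

section Separated

variable {G X : Type*} [Group G] {α : G → X → X} {f : X → ℝ} {ρ ρ₁ ρ₂ : X → X → ℝ}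
  {ε δ : ℝ} {F : Finset G} {d : ℕ} {σ : G → Equiv.Perm (Fin d)}

lemma le_rhoInf (φ ψ : Fin d → X) (a : Fin d) : ρ (φ a) (ψ a) ≤ rhoInf ρ φ ψ :=
  le_ciSup (f := fun a => ρ (φ a) (ψ a)) (Set.finite_range _).bddAbove a

lemma rhoInf_lt_iff (hd : 0 < d) {φ ψ : Fin d → X} :
    rhoInf ρ φ ψ < ε ↔ ∀ a, ρ (φ a) (ψ a) < ε := by
  have : Nonempty (Fin d) := ⟨⟨0, hd⟩⟩
  refine ⟨fun h a => (le_rhoInf φ ψ a).trans_lt h, fun h => ?_⟩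
  obtain ⟨a, ha⟩ := exists_eq_ciSup_of_finite (f := fun a => ρ (φ a) (ψ a))
  rw [rhoInf, ← ha]
  exact h a

lemma bddAbove_separated [TopologicalSpace X] [CompactSpace X] (hρ : IsContPseudoMetric X ρ)
    (hf : Continuous f) (hε : 0 < ε) (hd : 0 < d) (Y : Set (Fin d → X)) :
    BddAbove {r : ℝ | ∃ E : Finset (Fin d → X), ↑E ⊆ Y ∧
      (∀ φ ∈ E, ∀ ψ ∈ E, φ ≠ ψ → ε ≤ rhoInf ρ φ ψ) ∧
      r = ∑ φ ∈ E, Real.exp (∑ a, f (φ a))} := by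
  obtain ⟨B, hB⟩ := isCompact_univ.exists_bound_of_continuousOn hf.continuousOn
  obtain ⟨t, c, hc⟩ := hρ.exists_finite_partition hε
  refine ⟨Fintype.card (Fin d → t) * Real.exp (d * B), ?_⟩
  rintro _ ⟨E, -, hE, rfl⟩
  have hcard : E.card ≤ Fintype.card (Fin d → t) := by
    refine Finset.card_le_card_of_injOn (fun φ a => c (φ a)) (fun _ _ => Finset.mem_univ _) ?_
    intro φ hφ ψ hψ h
    by_contra hne
    exact absurd (hE φ hφ ψ hψ hne)
      (not_le.2 ((rhoInf_lt_iff hd).2 fun a => hc _ _ (congrFun h a)))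
  calc ∑ φ ∈ E, Real.exp (∑ a, f (φ a)) ≤ ∑ φ ∈ E, Real.exp (d * B) := by
        refine Finset.sum_le_sum fun φ _ => Real.exp_le_exp.2 ?_
        calc ∑ a, f (φ a) ≤ ∑ _a : Fin d, B :=
              Finset.sum_le_sum fun a _ => (le_abs_self _).trans (hB _ trivial)
          _ = d * B := by simp
    _ = E.card * Real.exp (d * B) := by simp
    _ ≤ _ := by gcongr

lemma sum_le_Mval [TopologicalSpace X] [CompactSpace X] (hρ : IsContPseudoMetric X ρ)
    (hf : Continuous f) (hε : 0 < ε) (hd : 0 < d) {E : Finset (Fin d → X)}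
    (hE : ↑E ⊆ MapSet α ρ F δ σ) (hsep : ∀ φ ∈ E, ∀ ψ ∈ E, φ ≠ ψ → ε ≤ rhoInf ρ φ ψ) :
    ∑ φ ∈ E, Real.exp (∑ a, f (φ a)) ≤ Mval α f ρ ε F δ σ (rhoInf ρ) :=
  le_csSup (bddAbove_separated hρ hf hε hd _) ⟨E, hE, hsep, rfl⟩

lemma Mval_pos [TopologicalSpace X] [CompactSpace X] (hρ : IsContPseudoMetric X ρ)
    (hf : Continuous f) (hε : 0 < ε) (hd : 0 < d) (hne : (MapSet α ρ F δ σ).Nonempty) :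
    0 < Mval α f ρ ε F δ σ (rhoInf ρ) := by
  obtain ⟨φ, hφ⟩ := hne
  refine lt_of_lt_of_le (Real.exp_pos (∑ a, f (φ a)))
    ((Finset.sum_singleton _ _).symm.trans_le
      (sum_le_Mval (E := {φ}) hρ hf hε hd (by simpa using hφ) ?_))
  simp only [Finset.mem_singleton]
  rintro _ rfl _ rfl h
  exact absurd rfl h

/-- Two separation problems are compared by coding: if separated points for `ρ₁` with the same code
are separated for `ρ₂`, and there are at most `exp (β d)` codes, then the pressure terms differ
by at most `β`. -/
lemma pressureTerm_le_add_of_code [TopologicalSpace X] [CompactSpace X]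
    (h₁ : IsContPseudoMetric X ρ₁) (h₂ : IsContPseudoMetric X ρ₂) (hf : Continuous f)
    {ε₁ ε₂ δ₁ δ₂ β : ℝ} {F₁ F₂ : Finset G} (hε₁ : 0 < ε₁) (hε₂ : 0 < ε₂) (hd : 0 < d)
    (hsub : MapSet α ρ₁ F₁ δ₁ σ ⊆ MapSet α ρ₂ F₂ δ₂ σ)
    {W : Type*} [DecidableEq W] (code : (Fin d → X) → W)
    (hcard : ∀ E : Finset (Fin d → X), ↑E ⊆ MapSet α ρ₁ F₁ δ₁ σ →
      ((E.image code).card : ℝ) ≤ Real.exp (β * d))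
    (hcode : ∀ φ ∈ MapSet α ρ₁ F₁ δ₁ σ, ∀ ψ ∈ MapSet α ρ₁ F₁ δ₁ σ, code φ = code ψ →
      rhoInf ρ₂ φ ψ < ε₂ → rhoInf ρ₁ φ ψ < ε₁) :
    pressureTerm α f ρ₁ ε₁ F₁ δ₁ σ ≤ pressureTerm α f ρ₂ ε₂ F₂ δ₂ σ + (β : EReal) := by
  by_cases hne : (MapSet α ρ₁ F₁ δ₁ σ).Nonempty
  swap
  · simp [pressureTerm, hne]
  have hne₂ := hne.mono hsub
  have hd' : (0 : ℝ) < d := by exact_mod_cast hd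
  rw [pressureTerm, if_pos hne, pressureTerm, if_pos hne₂, ← EReal.coe_add, EReal.coe_le_coe_iff,
    div_add' _ _ _ hd'.ne', div_le_div_iff_of_pos_right hd']
  have hM₂ := Mval_pos h₂ hf hε₂ hd hne₂
  have hM : Mval α f ρ₁ ε₁ F₁ δ₁ σ (rhoInf ρ₁)
      ≤ Real.exp (β * d) * Mval α f ρ₂ ε₂ F₂ δ₂ σ (rhoInf ρ₂) := by
    refine csSup_le ⟨0, ∅, by simp⟩ ?_
    rintro _ ⟨E, hE, hsep, rfl⟩
    rw [← Finset.sum_fiberwise_of_maps_to (g := code) (t := E.image code)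
      fun φ hφ => Finset.mem_image_of_mem _ hφ]
    calc _ ≤ ∑ _w ∈ E.image code, Mval α f ρ₂ ε₂ F₂ δ₂ σ (rhoInf ρ₂) := by
          refine Finset.sum_le_sum fun w _ => sum_le_Mval h₂ hf hε₂ hd ?_ ?_
          · intro φ hφ
            exact hsub (hE (Finset.mem_filter.1 hφ).1)
          · intro φ hφ ψ hψ hφψ
            rw [Finset.mem_filter] at hφ hψ
            by_contra! hlt
            exact absurd (hsep φ hφ.1 ψ hψ.1 hφψ) (not_le.2
              (hcode φ (hE hφ.1) ψ (hE hψ.1) (hφ.2.trans hψ.2.symm) hlt))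
      _ = (E.image code).card * Mval α f ρ₂ ε₂ F₂ δ₂ σ (rhoInf ρ₂) := by simp
      _ ≤ _ := by gcongr; exact hcard E hE
  calc _ ≤ Real.log (Real.exp (β * d) * Mval α f ρ₂ ε₂ F₂ δ₂ σ (rhoInf ρ₂)) :=
        Real.log_le_log (Mval_pos h₁ hf hε₁ hd hne) hM
    _ = _ := by rw [Real.log_mul (Real.exp_pos _).ne' hM₂.ne', Real.log_exp, add_comm]

end Separated

lemma PressureInf_le_of_pressureTerm_le {G X : Type*} [Group G] {α : G → X → X} {f : X → ℝ}
    {ρ₁ ρ₂ : X → X → ℝ} {d : ℕ → ℕ} {σ : ∀ i, G → Equiv.Perm (Fin (d i))}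
    (h : ∀ ε₁ > 0, ∃ ε₂ > 0, ∀ F₂ : Finset G, ∀ δ₂ > 0, ∀ β > (0 : ℝ),
      ∃ F₁ : Finset G, F₁.Nonempty ∧ ∃ δ₁ > 0, ∀ᶠ i in atTop,
        pressureTerm α f ρ₁ ε₁ F₁ δ₁ (σ i) ≤
          pressureTerm α f ρ₂ ε₂ F₂ δ₂ (σ i) + (β : EReal)) :
    PressureInf α f ρ₁ d σ ≤ PressureInf α f ρ₂ d σ := by
  refine iSup₂_le fun ε₁ hε₁ => ?_
  obtain ⟨ε₂, hε₂, h⟩ := h ε₁ hε₁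
  refine le_iSup₂_of_le ε₂ hε₂ (le_iInf₂ fun F₂ _ => le_iInf₂ fun δ₂ hδ₂ => ?_)
  refine le_of_forall_gt fun c hc => ?_
  obtain ⟨c₂, hc₂, hc₂c⟩ := EReal.lt_iff_exists_real_btwn.1 hc
  obtain ⟨c₁, hc₁, hc₁c₂⟩ := EReal.lt_iff_exists_real_btwn.1 hc₂
  rw [EReal.coe_lt_coe_iff] at hc₁c₂
  obtain ⟨F₁, hF₁, δ₁, hδ₁, hle⟩ := h F₂ δ₂ hδ₂ (c₂ - c₁) (by linarith)
  refine lt_of_le_of_lt (iInf₂_le_of_le F₁ hF₁ (iInf₂_le_of_le δ₁ hδ₁ ?_)) hc₂c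
  refine limsup_le_of_le (by isBoundedDefault) ?_
  filter_upwards [hle, eventually_lt_of_limsup_lt hc₁] with i hi hi'
  refine hi.trans ((add_le_add_left hi'.le _).trans_eq ?_)
  rw [← EReal.coe_add]
  simp

section Comparison

variable {G X : Type*} [Group G] [TopologicalSpace X] [CompactSpace X]
  {α : G → X → X} {f : X → ℝ} {ρ : X → X → ℝ} {s : ℕ → G}
  {d : ℕ → ℕ} {σ : ∀ i, G → Equiv.Perm (Fin (d i))}

lemma IsSoficApprox.eventually_card_le (hσ : IsSoficApprox G d σ) (g h : G) {η : ℝ} (hη : 0 < η) :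
    ∀ᶠ i in atTop, ((Finset.univ.filter fun a => σ i g (σ i h a) ≠ σ i (g * h) a).card : ℝ)
      ≤ η * d i := by
  filter_upwards [(hσ.mul g h).eventually (lt_mem_nhds (show 1 - η < 1 by linarith)),
    hσ.dim_top.eventually_gt_atTop 0] with i hi hd
  have hd' : (0 : ℝ) < d i := by exact_mod_cast hd
  rw [lt_div_iff₀ hd'] at hi
  have := Finset.card_filter_add_card_filter_not (s := Finset.univ)
    (fun a => σ i g (σ i h a) = σ i (g * h) a)
  rw [Finset.card_univ, Fintype.card_fin] at this
  have : ((Finset.univ.filter fun a => σ i g (σ i h a) = σ i (g * h) a).card : ℝ)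
    + (Finset.univ.filter fun a => σ i g (σ i h a) ≠ σ i (g * h) a).card = d i := by
      exact_mod_cast this
  linarith

lemma MapSet_orbitMetric_subset (hρ : IsContPseudoMetric X ρ) (hα : ContAction G X α)
    (hs0 : s 0 = 1) {F F₁ : Finset G} (hF : F ⊆ F₁) {δ δ₁ : ℝ} (hδ : 0 < δ) (hδ₁ : δ₁ ≤ δ / 2)
    {n : ℕ} (τ : G → Equiv.Perm (Fin n)) :
    MapSet α (orbitMetric α ρ s) F₁ δ₁ τ ⊆ MapSet α ρ F δ τ := by
  intro φ hφ g hg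
  have h := hφ g (hF hg)
  rw [rho2, Real.sqrt_lt' hδ]
  have hlt := h.trans_le hδ₁
  rw [rho2, Real.sqrt_lt' (by positivity)] at hlt
  have : ∑ a, ρ (α g (φ a)) (φ (τ g a)) ^ 2
      ≤ 4 * ∑ a, orbitMetric α ρ s (α g (φ a)) (φ (τ g a)) ^ 2 := by
    rw [Finset.mul_sum]
    refine Finset.sum_le_sum fun a _ => ?_
    have := pow_le_pow_left₀ (hρ.nonneg _ _)
      (le_two_mul_orbitMetric (s := s) hρ hα hs0 (α g (φ a)) (φ (τ g a))) 2
    linarith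
  have := mul_le_mul_of_nonneg_left this (show 0 ≤ 1 / (n : ℝ) by positivity)
  linarith

lemma exists_MapSet_subset_orbitMetric (hρ : IsContPseudoMetric X ρ) (hα : ContAction G X α)
    (hσ : IsSoficApprox G d σ) (s : ℕ → G) (F : Finset G) {δ : ℝ} (hδ : 0 < δ) :
    ∃ F₁ : Finset G, F₁.Nonempty ∧ ∃ δ₁ > 0, ∀ᶠ i in atTop,
      MapSet α ρ F₁ δ₁ (σ i) ⊆ MapSet α (orbitMetric α ρ s) F δ (σ i) := by
  have hρ' := isContPseudoMetric_orbitMetric (s := s) hρ hα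
  obtain ⟨C, hC0, hC⟩ := hρ'.exists_bound
  obtain ⟨N, hN⟩ := exists_orbitMetric_lt hρ α s (half_pos hδ)
  let η : ℝ := δ ^ 2 / (4 * C ^ 2)
  let κ : ℝ := δ / 8
  let η₁ : ℝ := η / (3 * (N + 1))
  have hη₁ : 0 < η₁ := by positivity
  have hκ : 0 < κ := by positivity
  refine ⟨insert 1 ((Finset.range N).image s ∪
    Finset.image₂ (fun n g => s n * g) (Finset.range N) F), Finset.insert_nonempty _ _,
    κ * Real.sqrt η₁, by positivity, ?_⟩
  have hev : ∀ᶠ i in atTop, ∀ g ∈ F, ∀ n ∈ Finset.range N,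
      ((Finset.univ.filter fun a => σ i (s n) (σ i g a) ≠ σ i (s n * g) a).card : ℝ)
        ≤ η₁ * d i := by
    simp only [Filter.eventually_all_finset]
    exact fun g _ n _ => hσ.eventually_card_le (s n) g hη₁
  filter_upwards [hev, hσ.dim_top.eventually_gt_atTop 0] with i hi hd φ hφ g hg
  have hmarkov : ∀ k ∈ insert 1 ((Finset.range N).image s ∪
      Finset.image₂ (fun n g => s n * g) (Finset.range N) F),
      ((Finset.univ.filter fun a => κ ≤ ρ (α k (φ a)) (φ (σ i k a))).card : ℝ) ≤ η₁ * d i := by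
    intro k hk
    have := card_mul_sq_le_of_rho2_lt hκ.le (hφ k hk)
    rw [mul_pow, Real.sq_sqrt hη₁.le, mul_comm, mul_assoc] at this
    exact le_of_mul_le_mul_left this (by positivity)
  let B₁ : ℕ → Finset (Fin (d i)) := fun n =>
    Finset.univ.filter fun a => κ ≤ ρ (α (s n * g) (φ a)) (φ (σ i (s n * g) a))
  let B₂ : ℕ → Finset (Fin (d i)) := fun n =>
    Finset.univ.filter fun a => κ ≤ ρ (α (s n) (φ (σ i g a))) (φ (σ i (s n) (σ i g a)))
  let B₃ : ℕ → Finset (Fin (d i)) := fun n =>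
    Finset.univ.filter fun a => σ i (s n) (σ i g a) ≠ σ i (s n * g) a
  have hB₁ : ∀ n ∈ Finset.range N, ((B₁ n).card : ℝ) ≤ η₁ * d i := fun n hn =>
    hmarkov _ (Finset.mem_insert_of_mem (Finset.mem_union_right _
      (Finset.mem_image₂_of_mem hn hg)))
  have hB₂ : ∀ n ∈ Finset.range N, ((B₂ n).card : ℝ) ≤ η₁ * d i := fun n hn => by
    refine le_trans ?_ (hmarkov (s n) (Finset.mem_insert_of_mem (Finset.mem_union_left _
      (Finset.mem_image_of_mem _ hn))))
    exact_mod_cast Finset.card_le_card_of_injOn (σ i g)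
      (fun a ha => by simpa [B₂] using ha) (σ i g).injective.injOn
  have hsub : (Finset.univ.filter fun a =>
      δ / 2 ≤ orbitMetric α ρ s (α g (φ a)) (φ (σ i g a))) ⊆
        (Finset.range N).biUnion fun n => B₁ n ∪ B₂ n ∪ B₃ n := by
    intro a ha
    by_contra hbad
    refine absurd (Finset.mem_filter.1 ha).2 (not_le.2 (hN _ _ fun n hn => ?_))
    have hbad' : a ∉ B₁ n ∪ B₂ n ∪ B₃ n := fun h =>
      hbad (Finset.mem_biUnion.2 ⟨n, Finset.mem_range.2 hn, h⟩)
    simp only [B₁, B₂, B₃, Finset.mem_union, Finset.mem_filter, Finset.mem_univ, true_and,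
      not_or, not_le, not_not] at hbad'
    obtain ⟨⟨h₁, h₂⟩, h₃⟩ := hbad'
    rw [h₃, hρ.symm] at h₂
    rw [hα.mul] at h₁
    have := hρ.triangle (α (s n) (α g (φ a))) (φ (σ i (s n * g) a)) (α (s n) (φ (σ i g a)))
    dsimp only [κ] at h₁ h₂
    linarith
  refine rho2_lt_of_card_le (κ := δ / 2) (η := η) hd hρ'.nonneg hC hδ ?_ ?_
  · calc _ ≤ (((Finset.range N).biUnion fun n => B₁ n ∪ B₂ n ∪ B₃ n).card : ℝ) := by
          exact_mod_cast Finset.card_le_card hsub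
      _ ≤ ∑ n ∈ Finset.range N, ((B₁ n ∪ B₂ n ∪ B₃ n).card : ℝ) := by
          exact_mod_cast Finset.card_biUnion_le
      _ ≤ ∑ n ∈ Finset.range N, (3 * (η₁ * d i)) := by
          refine Finset.sum_le_sum fun n hn => ?_
          have hu : ((B₁ n ∪ B₂ n ∪ B₃ n).card : ℝ)
              ≤ (B₁ n).card + (B₂ n).card + (B₃ n).card := by
            exact_mod_cast (Finset.card_union_le _ _).trans
              (Nat.add_le_add_right (Finset.card_union_le _ _) _)
          linarith [hB₁ n hn, hB₂ n hn, hi g hg n hn]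
      _ = N * (3 * (η₁ * d i)) := by simp
      _ ≤ (N + 1) * (3 * (η₁ * d i)) := by gcongr; linarith
      _ = η * d i := by dsimp only [η₁]; field_simp
  · have : C ^ 2 * η = δ ^ 2 / 4 := by dsimp only [η]; field_simp
    rw [this]
    nlinarith [pow_pos hδ 2]

lemma PressureInf_le_orbitMetric (hρ : IsContPseudoMetric X ρ) (hα : ContAction G X α)
    (hσ : IsSoficApprox G d σ) (hf : Continuous f) (hs0 : s 0 = 1) :
    PressureInf α f ρ d σ ≤ PressureInf α f (orbitMetric α ρ s) d σ := by
  have hρ' := isContPseudoMetric_orbitMetric (s := s) hρ hα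
  refine PressureInf_le_of_pressureTerm_le fun ε hε => ⟨ε / 2, half_pos hε, fun F δ hδ β hβ => ?_⟩
  obtain ⟨F₁, hF₁, δ₁, hδ₁, hev⟩ := exists_MapSet_subset_orbitMetric hρ hα hσ s F hδ
  refine ⟨F₁, hF₁, δ₁, hδ₁, ?_⟩
  filter_upwards [hev, hσ.dim_top.eventually_gt_atTop 0] with i hi hd
  refine pressureTerm_le_add_of_code hρ hρ' hf hε (half_pos hε) hd hi (fun _ => ()) ?_ ?_
  · intro E _
    refine le_trans ?_ (Real.one_le_exp (by positivity))
    exact_mod_cast Finset.card_le_one_of_subsingleton _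
  · intro φ _ ψ _ _ h
    rw [rhoInf_lt_iff hd] at h ⊢
    intro a
    linarith [h a, le_two_mul_orbitMetric (s := s) hρ hα hs0 (φ a) (ψ a)]

lemma PressureInf_orbitMetric_le (hρ : IsContPseudoMetric X ρ) (hα : ContAction G X α)
    (hσ : IsSoficApprox G d σ) (hf : Continuous f) (hs0 : s 0 = 1) :
    PressureInf α f (orbitMetric α ρ s) d σ ≤ PressureInf α f ρ d σ := by
  have hρ' := isContPseudoMetric_orbitMetric (s := s) hρ hα
  refine PressureInf_le_of_pressureTerm_le fun ε hε => ⟨ε / 6, by positivity,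
    fun F δ hδ β hβ => ?_⟩
  obtain ⟨N, hN⟩ := exists_orbitMetric_lt hρ α s hε
  obtain ⟨t, c, hc⟩ := hρ'.exists_finite_partition hε
  obtain ⟨L, hL, hL0⟩ : ∃ L : ℝ, (Fintype.card t : ℝ) * Real.exp (-L) ≤ β / 2 ∧ 0 ≤ L := by
    have : Tendsto (fun L : ℝ => (Fintype.card t : ℝ) * Real.exp (-L)) atTop (nhds 0) := by
      simpa using Real.tendsto_exp_neg_atTop_nhds_zero.const_mul (Fintype.card t : ℝ)
    exact ((this.eventually (ge_mem_nhds (half_pos hβ))).and (eventually_ge_atTop 0)).exists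
  let η : ℝ := β / 2 / (L + 1)
  let κ : ℝ := ε / 6
  let η₁ : ℝ := η / (N + 1)
  have hη₁ : 0 < η₁ := by positivity
  have hκ : 0 < κ := by positivity
  have hLη : L * η ≤ β / 2 := by
    have : (L + 1) * η = β / 2 := by dsimp only [η]; field_simp
    have : 0 < η := by positivity
    linarith
  let δ₀ : ℝ := κ * Real.sqrt η₁
  have hδ₀ : 0 < δ₀ := by positivity
  refine ⟨insert 1 (F ∪ (Finset.range N).image s), Finset.insert_nonempty _ _,
    min (δ / 2) (δ₀ / 2), by positivity, ?_⟩
  filter_upwards [hσ.dim_top.eventually_gt_atTop 0] with i hd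
  let bad : (Fin (d i) → X) → Fin (d i) → Prop := fun φ a =>
    ∃ n ∈ Finset.range N, κ ≤ ρ (α (s n) (φ a)) (φ (σ i (s n) a))
  let code : (Fin (d i) → X) → Fin (d i) → Option t := fun φ a =>
    if bad φ a then some (c (φ a)) else none
  refine pressureTerm_le_add_of_code hρ' hρ hf hε (by positivity) hd
    (MapSet_orbitMetric_subset hρ hα hs0
      (Finset.subset_union_left.trans (Finset.subset_insert _ _)) hδ (min_le_left _ _) _)
    code ?_ ?_
  · intro E hE
    refine card_words_le hL0 hL hLη _ fun w hw => ?_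
    obtain ⟨φ, hφ, rfl⟩ := Finset.mem_image.1 hw
    have hφ' : φ ∈ MapSet α ρ ((Finset.range N).image s) δ₀ (σ i) :=
      MapSet_orbitMetric_subset hρ hα hs0
        (Finset.subset_union_right.trans (Finset.subset_insert _ _)) hδ₀ (min_le_right _ _) _
        (hE hφ)
    have hmarkov : ∀ n ∈ Finset.range N, ((Finset.univ.filter fun a =>
        κ ≤ ρ (α (s n) (φ a)) (φ (σ i (s n) a))).card : ℝ) ≤ η₁ * d i := by
      intro n hn
      have := card_mul_sq_le_of_rho2_lt hκ.le (hφ' (s n) (Finset.mem_image_of_mem _ hn))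
      rw [mul_pow, Real.sq_sqrt hη₁.le, mul_comm, mul_assoc] at this
      exact le_of_mul_le_mul_left this (by positivity)
    have hsub : (Finset.univ.filter fun a => code φ a ≠ none) ⊆ (Finset.range N).biUnion fun n =>
        Finset.univ.filter fun a => κ ≤ ρ (α (s n) (φ a)) (φ (σ i (s n) a)) := by
      intro a ha
      have : bad φ a := by
        by_contra h
        simp [code, h] at ha
      simpa [bad] using this
    calc _ ≤ (((Finset.range N).biUnion fun n => Finset.univ.filter fun a =>
            κ ≤ ρ (α (s n) (φ a)) (φ (σ i (s n) a))).card : ℝ) := by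
          exact_mod_cast Finset.card_le_card hsub
      _ ≤ ∑ n ∈ Finset.range N, ((Finset.univ.filter fun a =>
            κ ≤ ρ (α (s n) (φ a)) (φ (σ i (s n) a))).card : ℝ) := by
          exact_mod_cast Finset.card_biUnion_le
      _ ≤ ∑ n ∈ Finset.range N, η₁ * d i := Finset.sum_le_sum hmarkov
      _ = N * (η₁ * d i) := by simp
      _ ≤ (N + 1) * (η₁ * d i) := by gcongr; linarith
      _ = η * d i := by dsimp only [η₁]; field_simp
  · intro φ _ ψ _ hcode hlt
    rw [rhoInf_lt_iff hd] at hlt ⊢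
    intro a
    have ha := congrFun hcode a
    by_cases hφ : bad φ a <;> by_cases hψ : bad ψ a <;> simp only [code, hφ, hψ, if_true,
      if_false, Option.some.injEq, reduceCtorEq] at ha
    · exact hc _ _ ha
    · refine hN _ _ fun n hn => ?_
      simp only [bad, not_exists, not_and, not_le] at hφ hψ
      have h₁ := hφ n (Finset.mem_range.2 hn)
      have h₂ := hψ n (Finset.mem_range.2 hn)
      have h₃ := hlt (σ i (s n) a)
      have h₄ := hρ.triangle (α (s n) (φ a)) (φ (σ i (s n) a)) (α (s n) (ψ a))
      have h₅ := hρ.triangle (φ (σ i (s n) a)) (ψ (σ i (s n) a)) (α (s n) (ψ a))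
      rw [hρ.symm] at h₂
      dsimp only [κ] at h₁ h₂
      linarith

end Comparison

theorem stmt8 {G : Type*} [Group G] [Countable G]
    {X : Type*} [TopologicalSpace X] [CompactSpace X] [TopologicalSpace.MetrizableSpace X]
    (α : G → X → X) (hα : ContAction G X α)
    (d : ℕ → ℕ) (σ : ∀ i, G → Equiv.Perm (Fin (d i))) (hσ : IsSoficApprox G d σ)
    (f : X → ℝ) (hf : Continuous f)
    (ρ : X → X → ℝ) (hρ : IsContPseudoMetric X ρ)
    (hgen : ∀ x y : X, x ≠ y → ∃ s : G, 0 < ρ (α s x) (α s y))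
    (huc : ∀ θ : ℝ, 0 < θ → ∃ ε > 0, ∀ x y : X, ρ x y < ε → |f x - f y| < θ)
    (s : ℕ → G) (hs0 : s 0 = 1) (hssurj : Function.Surjective s)
    (ρ' : X → X → ℝ)
    (hρ'def : ∀ x y : X, ρ' x y = ∑' n : ℕ, (1 / 2 : ℝ) ^ (n + 1) * ρ (α (s n) x) (α (s n) y)) :
    IsCompatMetric X ρ' ∧ PressureInf α f ρ d σ = PressureInf α f ρ' d σ := by
  obtain rfl : ρ' = orbitMetric α ρ s := funext₂ hρ'def
  exact ⟨isCompatMetric_orbitMetric hρ hα hgen hssurj, le_antisymm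
    (PressureInf_le_orbitMetric hρ hα hσ hf hs0) (PressureInf_orbitMetric_le hρ hα hσ hf hs0)⟩

end Sofic
end

section
/- Let G be a countable amenable group, let 0 ≤ τ < 1, 0 < η < 1, let K be a nonempty finite subset of G, and let δ > 0. Then there are ℓ ∈ ℕ, nonempty finite sets F_1,…,F_ℓ ⊆ G with max_{1≤k≤ℓ} |KF_k \ F_k|/|F_k| < δ and max_{1≤k≤ℓ} |F_k K \ F_k|/|F_k| < δ, a finite set F ⊆ G containing the identity e, and η' > 0 such that: for every d ∈ ℕ and every map σ : G → Sym(d) for which there is a set B ⊆ [d] with |B| ≥ (1−η')d satisfying σ_s σ_t(a) = σ_{st}(a), σ_s(a) ≠ σ_{s'}(a), and σ_e(a) = a for all a ∈ B and all s,t,s' ∈ F with s ≠ s', and for every set V ⊆ [d] with |V| ≥ (1−τ)d, there exist C_1,…,C_ℓ ⊆ V such that (1) for every 1 ≤ k ≤ ℓ the map (s,c) ↦ σ_s(c) from F_k × C_k to σ(F_k)C_k is bijective, and (2) the sets σ(F_1)C_1,…,σ(F_ℓ)C_ℓ are pairwise disjoint and |⋃_{k=1}^ℓ σ(F_k)C_k|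 ≥ (1−τ−η)d. -/
open Filter MeasureTheory
open scoped Pointwise Classical BigOperators

namespace Sofic

section Folner

variable {G : Type*} [Group G] [DecidableEq G]

lemma exists_left_folner {Fol : ℕ → Finset G} (h : IsFolnerSeq G Fol) (E : Finset G)
    {κ : ℝ} (hκ : 0 < κ) :
    ∃ T : Finset G, T.Nonempty ∧
      ∀ s ∈ E, (((T.image fun t => s * t) \ T).card : ℝ) ≤ κ * T.card := by
  have hev : ∀ᶠ n in atTop, ∀ s ∈ E,
      (((((Fol n).image fun t => s * t) \ Fol n) ∪
        (Fol n \ ((Fol n).image fun t => s * t))).card : ℝ) / ((Fol n).card : ℝ) < κ :=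
    (Filter.eventually_all_finset E).2 fun s _ => (h.2 s).eventually_lt_const hκ
  obtain ⟨n, hn⟩ := hev.exists
  refine ⟨Fol n, h.1 n, fun s hs => ?_⟩
  have hpos : (0 : ℝ) < (Fol n).card := by exact_mod_cast (h.1 n).card_pos
  refine le_trans ?_ ((div_lt_iff₀ hpos).1 (hn s hs)).le
  exact_mod_cast Finset.card_le_card Finset.subset_union_left

/-- The number of ways to write `g` as a quotient `a * b⁻¹` of elements of `T`. -/
def quotCount (T : Finset G) (g : G) : ℕ := (T.filter fun b => g * b ∈ T).card

/-- The elements of `G` with more than `i` representations as a quotient of elements of `T`. -/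
def quotLevel (T : Finset G) (i : ℕ) : Finset G := (T * T⁻¹).filter fun g => i < quotCount T g

lemma mem_quotLevel {T : Finset G} {i : ℕ} {g : G} : g ∈ quotLevel T i ↔ i < quotCount T g := by
  refine ⟨fun h => (Finset.mem_filter.1 h).2, fun h => Finset.mem_filter.2 ⟨?_, h⟩⟩
  obtain ⟨b, hb⟩ := Finset.card_pos.1 (Nat.zero_lt_of_lt h)
  rw [Finset.mem_filter] at hb
  exact Finset.mem_mul.2 ⟨g * b, hb.2, b⁻¹, Finset.inv_mem_inv hb.1, by group⟩

lemma quotCount_le (T : Finset G) (g : G) : quotCount T g ≤ T.card :=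
  Finset.card_le_card (Finset.filter_subset _ _)

lemma sum_card_filter_mul_mem_le (U A B : Finset G) :
    ∑ g ∈ U, (A.filter fun b => g * b ∈ B).card ≤ A.card * B.card := by
  simp_rw [Finset.card_filter]
  rw [Finset.sum_comm, ← smul_eq_mul]
  refine Finset.sum_le_card_nsmul _ _ _ fun b _ => ?_
  rw [← Finset.card_filter]
  exact Finset.card_le_card_of_injOn (fun g => g * b)
    (fun g hg => (Finset.mem_filter.1 hg).2) (fun g _ g' _ h => mul_right_cancel h)

lemma sum_card_quotLevel (T : Finset G) :
    ∑ i ∈ Finset.range T.card, (quotLevel T i).card = T.card * T.card := by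
  have h1 : ∀ i, (quotLevel T i).card = ∑ g ∈ T * T⁻¹, if i < quotCount T g then 1 else 0 :=
    fun i => Finset.card_filter _ _
  simp_rw [h1]
  rw [Finset.sum_comm]
  have h2 : ∀ g, (∑ i ∈ Finset.range T.card, if i < quotCount T g then 1 else 0)
      = quotCount T g := by
    intro g
    rw [← Finset.card_filter]
    have : ((Finset.range T.card).filter fun i => i < quotCount T g)
        = Finset.range (quotCount T g) := by
      ext i
      have := quotCount_le T g
      simp only [Finset.mem_filter, Finset.mem_range]
      omega
    rw [this, Finset.card_range]
  simp_rw [h2, quotCount, Finset.card_filter]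
  rw [Finset.sum_comm, ← smul_eq_mul (T.card), ← Finset.sum_const]
  refine Finset.sum_congr rfl fun b hb => ?_
  rw [← Finset.card_filter]
  refine Finset.card_bij (fun g _ => g * b) (fun g hg => (Finset.mem_filter.1 hg).2)
    (fun g _ g' _ h => mul_right_cancel h) fun a ha => ⟨a * b⁻¹, ?_, by group⟩
  exact Finset.mem_filter.2 ⟨Finset.mul_mem_mul ha (Finset.inv_mem_inv hb), by simpa using ha⟩

lemma sum_card_image_sdiff_quotLevel_le (T : Finset G) (e : Equiv.Perm G) :
    ∑ i ∈ Finset.range T.card, ((quotLevel T i).image e \ quotLevel T i).card ≤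
      ∑ g ∈ (T * T⁻¹).image e, (quotCount T (e.symm g) - quotCount T g) := by
  have h1 : ∀ i, ((quotLevel T i).image e \ quotLevel T i) =
      ((T * T⁻¹).image e).filter fun g => i < quotCount T (e.symm g) ∧ quotCount T g ≤ i := by
    intro i
    ext g
    rw [Finset.mem_sdiff, mem_quotLevel, Finset.mem_filter, not_lt, ← and_assoc]
    refine and_congr_left fun _ => ?_
    simp only [Finset.mem_image]
    constructor
    · rintro ⟨a, ha, rfl⟩
      exact ⟨⟨a, (Finset.mem_filter.1 ha).1, rfl⟩, by simpa using mem_quotLevel.1 ha⟩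
    · rintro ⟨_, h⟩
      exact ⟨e.symm g, mem_quotLevel.2 h, by simp⟩
  simp_rw [h1, Finset.card_filter]
  rw [Finset.sum_comm]
  refine Finset.sum_le_sum fun g _ => ?_
  rw [← Finset.card_filter, ← Nat.card_Ico]
  refine Finset.card_le_card fun i hi => ?_
  simp only [Finset.mem_filter, Finset.mem_Ico] at hi ⊢
  omega

lemma sum_left_quotLevel_le (T : Finset G) (s : G) :
    ∑ i ∈ Finset.range T.card, ((quotLevel T i).image (fun t => s * t) \ quotLevel T i).card ≤
      T.card * (T.image (fun t => s * t) \ T).card := by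
  refine (sum_card_image_sdiff_quotLevel_le T (Equiv.mulLeft s)).trans <| le_trans
    (Finset.sum_le_sum fun g _ => ?_) (sum_card_filter_mul_mem_le ((T * T⁻¹).image (Equiv.mulLeft s))
      T (T.image (fun t => s * t) \ T))
  rw [quotCount, quotCount, Nat.sub_le_iff_le_add, add_comm]
  refine (Finset.card_le_card fun b hb => ?_).trans (Finset.card_union_le _ _)
  obtain ⟨hbT, hb⟩ := Finset.mem_filter.1 hb
  change s⁻¹ * g * b ∈ T at hb
  simp only [Finset.mem_filter, Finset.mem_union, Finset.mem_sdiff, Finset.mem_image]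
  by_cases hg : g * b ∈ T
  · exact Or.inl ⟨hbT, hg⟩
  · exact Or.inr ⟨hbT, ⟨s⁻¹ * g * b, hb, by group⟩, hg⟩

lemma sum_right_quotLevel_le (T : Finset G) (s : G) :
    ∑ i ∈ Finset.range T.card, ((quotLevel T i).image (fun t => t * s) \ quotLevel T i).card ≤
      (T.image (fun t => s⁻¹ * t) \ T).card * T.card := by
  refine (sum_card_image_sdiff_quotLevel_le T (Equiv.mulRight s)).trans <| le_trans
    (Finset.sum_le_sum fun g _ => ?_) (sum_card_filter_mul_mem_le
      ((T * T⁻¹).image (Equiv.mulRight s)) (T.image (fun t => s⁻¹ * t) \ T) T)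
  rw [quotCount, quotCount, Nat.sub_le_iff_le_add, add_comm]
  refine le_trans ?_ (Finset.card_union_le _ _)
  refine Finset.card_le_card_of_injOn (fun b => s⁻¹ * b) (fun b hb => ?_)
    (fun b _ b' _ h => mul_left_cancel h)
  obtain ⟨hbT, hb⟩ := Finset.mem_filter.1 hb
  change g * s⁻¹ * b ∈ T at hb
  rw [mul_assoc] at hb
  simp only [Finset.mem_coe, Finset.mem_union, Finset.mem_filter, Finset.mem_sdiff,
    Finset.mem_image]
  by_cases hg : s⁻¹ * b ∈ T
  · exact Or.inl ⟨hg, hb⟩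
  · exact Or.inr ⟨⟨⟨b, hbT, rfl⟩, hg⟩, hb⟩

lemma card_mul_sdiff_le (E T : Finset G) :
    ((E * T) \ T).card ≤ ∑ s ∈ E, (T.image (fun t => s * t) \ T).card := by
  refine le_trans (Finset.card_le_card fun g hg => ?_) Finset.card_biUnion_le
  obtain ⟨hg, hgT⟩ := Finset.mem_sdiff.1 hg
  obtain ⟨s, hs, t, ht, rfl⟩ := Finset.mem_mul.1 hg
  exact Finset.mem_biUnion.2
    ⟨s, hs, Finset.mem_sdiff.2 ⟨Finset.mem_image.2 ⟨t, ht, rfl⟩, hgT⟩⟩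

lemma card_mul_sdiff_le' (E T : Finset G) :
    ((T * E) \ T).card ≤ ∑ s ∈ E, (T.image (fun t => t * s) \ T).card := by
  refine le_trans (Finset.card_le_card fun g hg => ?_) Finset.card_biUnion_le
  obtain ⟨hg, hgT⟩ := Finset.mem_sdiff.1 hg
  obtain ⟨t, ht, s, hs, rfl⟩ := Finset.mem_mul.1 hg
  exact Finset.mem_biUnion.2
    ⟨s, hs, Finset.mem_sdiff.2 ⟨Finset.mem_image.2 ⟨t, ht, rfl⟩, hgT⟩⟩

/-- A group with left Følner sets has two-sided Følner sets. -/
lemma exists_two_sided_folner (hamen : ∃ Fol : ℕ → Finset G, IsFolnerSeq G Fol)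
    (E : Finset G) {κ : ℝ} (hκ : 0 < κ) :
    ∃ T : Finset G, T.Nonempty ∧ (((E * T) \ T).card : ℝ) ≤ κ * T.card ∧
      (((T * E) \ T).card : ℝ) ≤ κ * T.card := by
  obtain ⟨Fol, hFol⟩ := hamen
  set m : ℝ := 2 * E.card + 1 with hm
  have hm0 : 0 < m := by positivity
  obtain ⟨T, hT, hTE⟩ := exists_left_folner hFol (E ∪ E⁻¹) (div_pos hκ hm0)
  have hTpos : (0 : ℝ) < T.card := by exact_mod_cast hT.card_pos
  set D : ℕ → ℕ := fun i => ∑ s ∈ E, (((quotLevel T i).image (fun t => s * t) \ quotLevel T i).card +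
    ((quotLevel T i).image (fun t => t * s) \ quotLevel T i).card) with hD
  have hsum : ((∑ i ∈ Finset.range T.card, D i : ℕ) : ℝ)
      < ∑ i ∈ Finset.range T.card, κ * ((quotLevel T i).card : ℝ) := by
    rw [← Finset.mul_sum, ← Nat.cast_sum, sum_card_quotLevel, Finset.sum_comm]
    push_cast
    have hs : ∀ s ∈ E, ((∑ i ∈ Finset.range T.card,
        ((((quotLevel T i).image (fun t => s * t) \ quotLevel T i).card : ℝ) +
        ((quotLevel T i).image (fun t => t * s) \ quotLevel T i).card)) : ℝ)
        ≤ 2 * (κ / m) * (T.card * T.card) := by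
      intro s hs
      have h1 := hTE s (Finset.mem_union_left _ hs)
      have h2 := hTE s⁻¹ (Finset.mem_union_right _ (Finset.inv_mem_inv hs))
      have h3 : ((∑ i ∈ Finset.range T.card,
        ((quotLevel T i).image (fun t => s * t) \ quotLevel T i).card : ℕ) : ℝ) ≤ _ :=
        Nat.cast_le.2 (sum_left_quotLevel_le T s)
      have h4 : ((∑ i ∈ Finset.range T.card,
        ((quotLevel T i).image (fun t => t * s) \ quotLevel T i).card : ℕ) : ℝ) ≤ _ :=
        Nat.cast_le.2 (sum_right_quotLevel_le T s)
      push_cast at h3 h4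
      rw [Finset.sum_add_distrib]
      nlinarith [mul_le_mul_of_nonneg_left h1 hTpos.le, mul_le_mul_of_nonneg_left h2 hTpos.le]
    refine (Finset.sum_le_card_nsmul _ _ _ hs).trans_lt ?_
    rw [nsmul_eq_mul]
    have hTT : (0 : ℝ) < T.card * T.card := by positivity
    have h5 : κ / m * m = κ := div_mul_cancel₀ κ hm0.ne'
    have h6 : 0 < κ / m := div_pos hκ hm0
    calc (E.card : ℝ) * (2 * (κ / m) * (T.card * T.card))
        < (κ / m * m) * (T.card * T.card) := by
          rw [hm] at *
          nlinarith [mul_pos h6 hTT]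
      _ = κ * (T.card * T.card) := by rw [h5]
  push_cast only [Nat.cast_sum] at hsum
  obtain ⟨i, -, hi⟩ := Finset.exists_lt_of_sum_lt hsum
  have hDi : ((D i : ℕ) : ℝ) < κ * ((quotLevel T i).card : ℝ) := by exact_mod_cast hi
  rw [hD] at hDi
  refine ⟨quotLevel T i, ?_, ?_, ?_⟩
  · by_contra h
    rw [Finset.not_nonempty_iff_eq_empty] at h
    simp [h] at hDi
  · refine le_trans (Nat.cast_le.2 ((card_mul_sdiff_le E _).trans ?_)) hDi.le
    exact Finset.sum_le_sum fun s _ => Nat.le_add_right _ _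
  · refine le_trans (Nat.cast_le.2 ((card_mul_sdiff_le' E _).trans ?_)) hDi.le
    exact Finset.sum_le_sum fun s _ => Nat.le_add_left _ _

/-- Two-sided Følner sets all of whose large subsets are almost invariant. -/
lemma exists_stable_folner (hamen : ∃ Fol : ℕ → Finset G, IsFolnerSeq G Fol)
    (E : Finset G) {ε θ : ℝ} (hε : ε ≤ 1 / 2) (hθ : 0 < θ) (hεθ : 4 * ε ≤ θ) :
    ∃ T : Finset G, T.Nonempty ∧ ∀ S ⊆ T, (1 - ε) * (T.card : ℝ) ≤ S.card →
      (((E * S) \ S).card : ℝ) ≤ θ * S.card ∧ (((S * E) \ S).card : ℝ) ≤ θ * S.card := by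
  obtain ⟨T, hT, hl, hr⟩ := exists_two_sided_folner hamen E (κ := θ / 4) (by positivity)
  refine ⟨T, hT, fun S hST hS => ?_⟩
  have hcard : ((T \ S).card : ℝ) = T.card - S.card := by
    rw [Finset.card_sdiff_of_subset hST, Nat.cast_sub (Finset.card_le_card hST)]
  have hT0 : (0 : ℝ) ≤ T.card := Nat.cast_nonneg _
  have key : ∀ A B : Finset G, A ⊆ B → ((B \ T).card : ℝ) ≤ θ / 4 * T.card →
      ((A \ S).card : ℝ) ≤ θ * S.card := by
    intro A B hAB hB
    have h1 : (A \ S).card ≤ (B \ T).card + (T \ S).card := by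
      refine (Finset.card_le_card fun g hg => ?_).trans (Finset.card_union_le _ _)
      obtain ⟨hgA, hgS⟩ := Finset.mem_sdiff.1 hg
      by_cases hgT : g ∈ T
      · exact Finset.mem_union_right _ (Finset.mem_sdiff.2 ⟨hgT, hgS⟩)
      · exact Finset.mem_union_left _ (Finset.mem_sdiff.2 ⟨hAB hgA, hgT⟩)
    have h2 : ((A \ S).card : ℝ) ≤ (B \ T).card + (T \ S).card := by exact_mod_cast h1
    have h3 : (T.card : ℝ) ≤ 2 * S.card := by nlinarith
    nlinarith [mul_le_mul_of_nonneg_right hεθ hT0, mul_le_mul_of_nonneg_left h3 hθ.le]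
  exact ⟨key _ _ (Finset.mul_subset_mul_left hST) hl, key _ _ (Finset.mul_subset_mul_right hST) hr⟩

lemma exists_folner_list (hamen : ∃ Fol : ℕ → Finset G, IsFolnerSeq G Fol)
    (K : Finset G) {ε θ : ℝ} (hε : ε ≤ 1 / 2) (hθ : 0 < θ) (hεθ : 4 * ε ≤ θ) (n : ℕ) :
    ∃ L : List (Finset G), L.length = n ∧
      (∀ T ∈ L, T.Nonempty ∧ ∀ S ⊆ T, (1 - ε) * (T.card : ℝ) ≤ S.card →
        (((K * S) \ S).card : ℝ) ≤ θ * S.card ∧ (((S * K) \ S).card : ℝ) ≤ θ * S.card) ∧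
      L.Pairwise fun T T' => ∀ S ⊆ T, (1 - ε) * (T.card : ℝ) ≤ S.card →
        (((T'⁻¹ * S) \ S).card : ℝ) ≤ θ * S.card := by
  induction n with
  | zero => exact ⟨[], rfl, by simp, List.Pairwise.nil⟩
  | succ n ih =>
    obtain ⟨L, hlen, hK, hL⟩ := ih
    obtain ⟨T, hT, hinv⟩ := exists_stable_folner hamen
      (K ∪ L.toFinset.biUnion fun T' => T'⁻¹) hε hθ hεθ
    have mono : ∀ {A B S : Finset G}, A ⊆ B → (((B * S) \ S).card : ℝ) ≤ θ * S.card →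
        (((A * S) \ S).card : ℝ) ≤ θ * S.card := fun hAB h => le_trans (Nat.cast_le.2
      (Finset.card_le_card (Finset.sdiff_subset_sdiff (Finset.mul_subset_mul_right hAB) le_rfl))) h
    refine ⟨T :: L, by simp [hlen], ?_, List.pairwise_cons.2 ⟨?_, hL⟩⟩
    · rintro T' hT'
      rcases List.mem_cons.1 hT' with rfl | hT'
      · refine ⟨hT, fun S hS hc => ⟨mono Finset.subset_union_left (hinv S hS hc).1, ?_⟩⟩
        refine le_trans (Nat.cast_le.2 (Finset.card_le_card (Finset.sdiff_subset_sdiff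
          (Finset.mul_subset_mul_left Finset.subset_union_left) le_rfl))) (hinv S hS hc).2
      · exact hK T' hT'
    · intro T' hT' S hS hc
      refine mono (fun g hg => Finset.mem_union_right _ ?_) (hinv S hS hc).1
      exact Finset.mem_biUnion.2 ⟨T', List.mem_toFinset.2 hT', hg⟩

end Folner

section Packing

variable {G : Type*} {d : ℕ}

/-- The tile of shape `S` centred at `c`. -/
def tile (σ : G → Equiv.Perm (Fin d)) (S : Finset G) (c : Fin d) : Finset (Fin d) :=
  S.image fun s => σ s c

/-- The union of the tiles in `P`. -/
def covered (σ : G → Equiv.Perm (Fin d)) (P : Finset (Finset G × Fin d)) : Finset (Fin d) :=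
  P.biUnion fun p => tile σ p.1 p.2

/-- `P` is a family of pairwise disjoint tiles with shapes inside `F` and centres in `W`. -/
structure IsPacking (σ : G → Equiv.Perm (Fin d)) (F : Finset G) (W : Finset (Fin d))
    (P : Finset (Finset G × Fin d)) : Prop where
  shape : ∀ p ∈ P, p.1 ⊆ F
  centre : ∀ p ∈ P, p.2 ∈ W
  disj : ∀ p ∈ P, ∀ q ∈ P, p ≠ q → Disjoint (tile σ p.1 p.2) (tile σ q.1 q.2)

variable {σ : G → Equiv.Perm (Fin d)} {F : Finset G} {W : Finset (Fin d)}
  {P : Finset (Finset G × Fin d)}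

lemma mem_covered {x : Fin d} : x ∈ covered σ P ↔ ∃ p ∈ P, ∃ s ∈ p.1, σ s p.2 = x := by
  simp [covered, tile]

lemma image_product_eq_biUnion_tile (S : Finset G) (C : Finset (Fin d)) :
    ((S ×ˢ C).image fun p => σ p.1 p.2) = C.biUnion fun c => tile σ S c := by
  ext x
  simp only [Finset.mem_image, Finset.mem_product, Finset.mem_biUnion, tile, Prod.exists]
  grind

variable [DecidableEq G]

lemma IsPacking.insert_tile (hP : IsPacking σ F W P) {S : Finset G} {c : Fin d} (hS : S ⊆ F)
    (hc : c ∈ W) (hdisj : Disjoint (tile σ S c) (covered σ P)) :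
    IsPacking σ F W (insert (S, c) P) where
  shape := by simpa using ⟨hS, fun a b => hP.shape (a, b)⟩
  centre := by simpa using ⟨hc, fun a b => hP.centre (a, b)⟩
  disj := by
    have h : ∀ q ∈ P, Disjoint (tile σ S c) (tile σ q.1 q.2) := fun q hq =>
      hdisj.mono_right (Finset.subset_biUnion_of_mem (fun p => tile σ p.1 p.2) hq)
    intro p hp q hq hpq
    rcases Finset.mem_insert.1 hp with rfl | hp <;> rcases Finset.mem_insert.1 hq with rfl | hq
    · exact absurd rfl hpq
    · exact h q hq
    · exact (h p hp).symm
    · exact hP.disj p hp q hq hpq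

variable [Group G]

/-- `σ` behaves on the points of `W` like a free action, as far as `F` can see. -/
structure IsFreeOn (σ : G → Equiv.Perm (Fin d)) (F : Finset G) (W : Finset (Fin d)) : Prop where
  mul : ∀ a ∈ W, ∀ s ∈ F, ∀ t ∈ F, σ s (σ t a) = σ (s * t) a
  inj : ∀ a ∈ W, ∀ s ∈ F, ∀ t ∈ F, s ≠ t → σ s a ≠ σ t a
  one : ∀ a ∈ W, σ 1 a = a

lemma IsFreeOn.card_tile (hσ : IsFreeOn σ F W) {S : Finset G} (hS : S ⊆ F) {c : Fin d}
    (hc : c ∈ W) : (tile σ S c).card = S.card :=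
  Finset.card_image_of_injOn fun s hs t ht h => by
    by_contra hst
    exact hσ.inj c hc s (hS hs) t (hS ht) hst h

lemma IsPacking.card_covered (hP : IsPacking σ F W P) (hσ : IsFreeOn σ F W) :
    (covered σ P).card = ∑ p ∈ P, p.1.card := by
  rw [covered, Finset.card_biUnion fun p hp q hq => hP.disj p hp q hq]
  exact Finset.sum_congr rfl fun p hp => hσ.card_tile (hP.shape p hp) (hP.centre p hp)

/-- If the shapes in `P` are almost invariant under `T⁻¹`, then few points outside the covered set
have a `T`-tile meeting it. -/
lemma IsPacking.card_boundary_le (hP : IsPacking σ F W P) (hσ : IsFreeOn σ F W) {T : Finset G}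
    (hT : T ⊆ F) (hT' : T⁻¹ ⊆ F) {θ : ℝ} (hθ : 0 ≤ θ)
    (hinv : ∀ p ∈ P, (((T⁻¹ * p.1) \ p.1).card : ℝ) ≤ θ * p.1.card) :
    (((W \ covered σ P).filter fun c => ¬ Disjoint (tile σ T c) (covered σ P)).card : ℝ)
      ≤ θ * d := by
  have hsub : ((W \ covered σ P).filter fun c => ¬ Disjoint (tile σ T c) (covered σ P)) ⊆
      P.biUnion fun p => tile σ ((T⁻¹ * p.1) \ p.1) p.2 := by
    intro c hc
    obtain ⟨hcW, hc⟩ := Finset.mem_filter.1 hc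
    obtain ⟨hcW, hcA⟩ := Finset.mem_sdiff.1 hcW
    obtain ⟨x, hxT, hxA⟩ := Finset.not_disjoint_iff.1 hc
    obtain ⟨t, ht, rfl⟩ := Finset.mem_image.1 hxT
    obtain ⟨p, hp, s, hs, hst⟩ := mem_covered.1 hxA
    have hti : t⁻¹ ∈ T⁻¹ := Finset.inv_mem_inv ht
    have hceq : σ (t⁻¹ * s) p.2 = c := by
      rw [← hσ.mul _ (hP.centre p hp) _ (hT' hti) _ (hP.shape p hp hs), hst,
        hσ.mul _ hcW _ (hT' hti) _ (hT ht), inv_mul_cancel, hσ.one _ hcW]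
    refine Finset.mem_biUnion.2 ⟨p, hp, Finset.mem_image.2 ⟨t⁻¹ * s, ?_, hceq⟩⟩
    exact Finset.mem_sdiff.2 ⟨Finset.mul_mem_mul hti hs,
      fun h => hcA (mem_covered.2 ⟨p, hp, _, h, hceq⟩)⟩
  calc _ ≤ ((∑ p ∈ P, ((T⁻¹ * p.1) \ p.1).card : ℕ) : ℝ) :=
        Nat.cast_le.2 <| (Finset.card_le_card hsub).trans <| Finset.card_biUnion_le.trans <|
          Finset.sum_le_sum fun p _ => Finset.card_image_le
    _ ≤ ∑ p ∈ P, θ * p.1.card := by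
        rw [Nat.cast_sum]
        exact Finset.sum_le_sum hinv
    _ = θ * (covered σ P).card := by
        rw [hP.card_covered hσ, ← Finset.mul_sum, Nat.cast_sum]
    _ ≤ θ * d := by
        refine mul_le_mul_of_nonneg_left ?_ hθ
        exact_mod_cast (Finset.card_le_univ _).trans_eq (Fintype.card_fin d)

lemma IsPacking.exists_extension (hP : IsPacking σ F W P) (hσ : IsFreeOn σ F W) {T : Finset G}
    (hT : T ⊆ F) (hT' : T⁻¹ ⊆ F) (hT0 : T.Nonempty) {ε θ : ℝ} (hε0 : 0 < ε) (hε1 : ε < 1)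
    (hθ : 0 ≤ θ) (hinv : ∀ p ∈ P, (((T⁻¹ * p.1) \ p.1).card : ℝ) ≤ θ * p.1.card) :
    ∃ P', IsPacking σ F W P' ∧
      (∀ p ∈ P', p ∈ P ∨ (p.1 ⊆ T ∧ (1 - ε) * (T.card : ℝ) ≤ p.1.card)) ∧
      ε * ((W.card : ℝ) - (covered σ P).card - θ * d)
        ≤ ((covered σ P').card : ℝ) - (covered σ P).card := by
  have hTpos : (0 : ℝ) < T.card := by exact_mod_cast hT0.card_pos
  let Q : Finset (Finset (Finset G × Fin d)) :=
    (P ∪ T.powerset ×ˢ Finset.univ).powerset.filter fun P' => P ⊆ P' ∧ IsPacking σ F W P' ∧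
      ∀ p ∈ P', p ∈ P ∨ (p.1 ⊆ T ∧ (1 - ε) * (T.card : ℝ) ≤ p.1.card)
  obtain ⟨P', hP'Q, hmax⟩ := Q.exists_max_image (fun P' => (covered σ P').card)
    ⟨P, Finset.mem_filter.2 ⟨Finset.mem_powerset.2 Finset.subset_union_left, subset_rfl, hP,
      fun p hp => Or.inl hp⟩⟩
  obtain ⟨hP'sub, hPP', hP', hshape⟩ := Finset.mem_filter.1 hP'Q
  refine ⟨P', hP', hshape, ?_⟩
  have hAA' : covered σ P ⊆ covered σ P' := Finset.biUnion_subset_biUnion_of_subset_left _ hPP'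
  have hhit : ∀ c ∈ W, ε * T.card ≤ (T.filter fun t => σ t c ∈ covered σ P').card := by
    intro c hc
    by_contra! hlt
    set S := T.filter fun t => σ t c ∉ covered σ P' with hSdef
    have hST : S ⊆ T := Finset.filter_subset _ _
    have hsplit : ((T.filter fun t => σ t c ∈ covered σ P').card : ℝ) + S.card = T.card := by
      exact_mod_cast Finset.card_filter_add_card_filter_not _
    have hS : (1 - ε) * (T.card : ℝ) ≤ S.card := by linarith
    have hdisj : Disjoint (tile σ S c) (covered σ P') := by
      rw [Finset.disjoint_left]
      intro x hx
      obtain ⟨s, hs, rfl⟩ := Finset.mem_image.1 hx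
      exact (Finset.mem_filter.1 hs).2
    have hmem : insert (S, c) P' ∈ Q := by
      refine Finset.mem_filter.2 ⟨Finset.mem_powerset.2 (Finset.insert_subset ?_
        (Finset.mem_powerset.1 hP'sub)), hPP'.trans (Finset.subset_insert _ _),
        hP'.insert_tile (hST.trans hT) hc hdisj, fun p hp => ?_⟩
      · exact Finset.mem_union_right _ (by simpa using hST)
      · rcases Finset.mem_insert.1 hp with rfl | hp
        · exact Or.inr ⟨hST, hS⟩
        · exact hshape p hp
    have hle := hmax _ hmem
    have hcov : covered σ (insert (S, c) P') = tile σ S c ∪ covered σ P' := Finset.biUnion_insert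
    rw [hcov, Finset.card_union_of_disjoint hdisj, hσ.card_tile (hST.trans hT) hc] at hle
    have hS0 : (S.card : ℝ) = 0 := by
      have : S.card = 0 := by omega
      exact_mod_cast this
    nlinarith
  let U := (W \ covered σ P).filter fun c => Disjoint (tile σ T c) (covered σ P)
  have hUcard : (W.card : ℝ) - (covered σ P).card - θ * d ≤ U.card := by
    have h1 := hP.card_boundary_le hσ hT hT' hθ hinv
    have h2 : (U.card : ℝ) + ((W \ covered σ P).filter
        fun c => ¬ Disjoint (tile σ T c) (covered σ P)).card = (W \ covered σ P).card := by
      exact_mod_cast Finset.card_filter_add_card_filter_not _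
    have h3 : (W.card : ℝ) ≤ (W \ covered σ P).card + (covered σ P).card := by
      exact_mod_cast Finset.card_le_card_sdiff_add_card
    linarith
  have hcount : ∑ c ∈ U, (T.filter fun t => σ t c ∈ covered σ P').card
      ≤ T.card * (covered σ P' \ covered σ P).card := by
    calc _ ≤ ∑ c ∈ U, (T.filter fun t => σ t c ∈ covered σ P' \ covered σ P).card := by
          refine Finset.sum_le_sum fun c hc => Finset.card_le_card fun t ht => ?_
          obtain ⟨ht, htA⟩ := Finset.mem_filter.1 ht
          exact Finset.mem_filter.2 ⟨ht, Finset.mem_sdiff.2 ⟨htA, Finset.disjoint_left.1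
            (Finset.mem_filter.1 hc).2 (Finset.mem_image_of_mem _ ht)⟩⟩
      _ ≤ _ := by
          simp_rw [Finset.card_filter]
          rw [Finset.sum_comm, ← smul_eq_mul]
          refine Finset.sum_le_card_nsmul _ _ _ fun t _ => ?_
          rw [← Finset.card_filter]
          exact Finset.card_le_card_of_injOn (σ t) (fun c hc => (Finset.mem_filter.1 hc).2)
            (σ t).injective.injOn
  have hlow : (U.card : ℝ) * (ε * T.card) ≤ T.card * (covered σ P' \ covered σ P).card := by
    rw [← nsmul_eq_mul]
    refine (Finset.card_nsmul_le_sum U _ _ fun c hc => hhit c ?_).trans (by exact_mod_cast hcount)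
    exact (Finset.mem_sdiff.1 (Finset.mem_filter.1 hc).1).1
  rw [Finset.card_sdiff_of_subset hAA', Nat.cast_sub (Finset.card_le_card hAA')] at hlow
  have hfin : ε * (U.card : ℝ) ≤ ((covered σ P').card : ℝ) - (covered σ P).card := by
    refine le_of_mul_le_mul_left ?_ hTpos
    linarith
  exact (mul_le_mul_of_nonneg_left hUcard hε0.le).trans hfin

lemma IsPacking.exists_iterated_extension (hσ : IsFreeOn σ F W) {ε θ : ℝ} (hε0 : 0 < ε)
    (hε1 : ε < 1) (hθ : 0 ≤ θ) (L : List (Finset G))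
    (hL : L.Pairwise fun T T' => ∀ S ⊆ T, (1 - ε) * (T.card : ℝ) ≤ S.card →
      (((T'⁻¹ * S) \ S).card : ℝ) ≤ θ * S.card)
    (hLF : ∀ T ∈ L, T.Nonempty ∧ T ⊆ F ∧ T⁻¹ ⊆ F) (hP : IsPacking σ F W P)
    (hinv : ∀ p ∈ P, ∀ T ∈ L, (((T⁻¹ * p.1) \ p.1).card : ℝ) ≤ θ * p.1.card) :
    ∃ P', IsPacking σ F W P' ∧
      (∀ p ∈ P', p ∈ P ∨ ∃ T ∈ L, p.1 ⊆ T ∧ (1 - ε) * (T.card : ℝ) ≤ p.1.card) ∧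
      (W.card : ℝ) - (covered σ P').card - θ * d ≤
        (1 - ε) ^ L.length * ((W.card : ℝ) - (covered σ P).card - θ * d) := by
  induction L generalizing P with
  | nil => exact ⟨P, hP, fun p hp => Or.inl hp, by simp⟩
  | cons T L ih =>
    obtain ⟨hTL, hL⟩ := List.pairwise_cons.1 hL
    obtain ⟨hT0, hTF, hTF'⟩ := hLF T List.mem_cons_self
    obtain ⟨P₁, hP₁, hshape₁, hcov₁⟩ := hP.exists_extension hσ hTF hTF' hT0 hε0 hε1 hθ
      fun p hp => hinv p hp T List.mem_cons_self
    obtain ⟨P₂, hP₂, hshape₂, hcov₂⟩ := ih hL (fun T' h => hLF T' (List.mem_cons_of_mem _ h)) hP₁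
      fun p hp T' hT' => (hshape₁ p hp).elim
        (fun h => hinv p h T' (List.mem_cons_of_mem _ hT')) fun h => hTL T' hT' _ h.1 h.2
    refine ⟨P₂, hP₂, fun p hp => ?_, hcov₂.trans ?_⟩
    · rcases hshape₂ p hp with h | ⟨T', hT', h⟩
      · exact (hshape₁ p h).imp id fun h => ⟨T, List.mem_cons_self, h⟩
      · exact Or.inr ⟨T', List.mem_cons_of_mem _ hT', h⟩
    · rw [List.length_cons, pow_succ, mul_assoc]
      exact mul_le_mul_of_nonneg_left (by linarith) (pow_nonneg (by linarith) _)

end Packing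

theorem stmt9 {G : Type*} [Group G] [Countable G] [DecidableEq G]
    (hamen : ∃ Fol : ℕ → Finset G, IsFolnerSeq G Fol)
    (τ η : ℝ) (hτ0 : 0 ≤ τ) (hτ1 : τ < 1) (hη0 : 0 < η) (hη1 : η < 1)
    (K : Finset G) (hK : K.Nonempty) (δ : ℝ) (hδ : 0 < δ) :
    ∃ (ℓ : ℕ) (Fk : Fin ℓ → Finset G), 0 < ℓ ∧ (∀ k, (Fk k).Nonempty) ∧
      (∀ k, (((K * Fk k) \ Fk k).card : ℝ) / ((Fk k).card : ℝ) < δ) ∧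
      (∀ k, (((Fk k * K) \ Fk k).card : ℝ) / ((Fk k).card : ℝ) < δ) ∧
      ∃ F : Finset G, (1 : G) ∈ F ∧ ∃ η' > (0 : ℝ),
        ∀ (d : ℕ) (σ : G → Equiv.Perm (Fin d)),
          (∃ B : Finset (Fin d), (1 - η') * (d : ℝ) ≤ (B.card : ℝ) ∧
            ∀ a ∈ B, (∀ s ∈ F, ∀ t ∈ F, σ s (σ t a) = σ (s * t) a) ∧
              (∀ s ∈ F, ∀ s' ∈ F, s ≠ s' → σ s a ≠ σ s' a) ∧ σ 1 a = a) →
          ∀ V : Finset (Fin d), (1 - τ) * (d : ℝ) ≤ (V.card : ℝ) →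
            ∃ C : Fin ℓ → Finset (Fin d), (∀ k, C k ⊆ V) ∧
              (∀ k, Set.InjOn (fun p : G × Fin d => σ p.1 p.2) ↑(Fk k ×ˢ C k)) ∧
              ((Set.univ : Set (Fin ℓ)).PairwiseDisjoint fun k =>
                (Fk k ×ˢ C k).image fun p => σ p.1 p.2) ∧
              (1 - τ - η) * (d : ℝ) ≤
                (((Finset.univ.biUnion fun k => (Fk k ×ˢ C k).image fun p => σ p.1 p.2)).card : ℝ) := by
  set θ : ℝ := min (η / 4) (δ / 2) with hθdef
  have hθ0 : 0 < θ := lt_min (by positivity) (by positivity)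
  have hθη : θ ≤ η / 4 := min_le_left _ _
  have hθδ : θ < δ := (min_le_right _ _).trans_lt (by linarith)
  set ε : ℝ := θ / 4 with hεdef
  have hε0 : 0 < ε := by positivity
  have hε2 : ε ≤ 1 / 2 := by linarith
  obtain ⟨n, hn⟩ := exists_pow_lt_of_lt_one (show (0 : ℝ) < η / 4 by positivity)
    (show 1 - ε < 1 by linarith)
  have hn' : (1 - ε) ^ (n + 1) ≤ η / 4 :=
    (pow_le_pow_of_le_one (by linarith) (by linarith) (Nat.le_succ n)).trans hn.le
  obtain ⟨L, hlen, hLK, hL⟩ := exists_folner_list hamen K hε2 hθ0 (by linarith) (n + 1)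
  let shapes : Finset (Finset G) := L.toFinset.biUnion fun T =>
    T.powerset.filter fun S => (1 - ε) * (T.card : ℝ) ≤ S.card
  have hmem : ∀ S, S ∈ shapes ↔ ∃ T ∈ L, S ⊆ T ∧ (1 - ε) * (T.card : ℝ) ≤ S.card := by
    intro S
    simp [shapes]
  have hpos : ∀ S ∈ shapes, (0 : ℝ) < S.card := by
    intro S hS
    obtain ⟨T, hT, -, hc⟩ := (hmem S).1 hS
    have : (0 : ℝ) < T.card := by exact_mod_cast (hLK T hT).1.card_pos
    exact (mul_pos (by linarith) this).trans_le hc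
  let e := shapes.equivFin
  have hshapes : ∀ k, ((e.symm k : Finset G)) ∈ shapes := fun k => (e.symm k).2
  refine ⟨shapes.card, fun k => e.symm k, ?_, fun k => ?_, fun k => ?_, fun k => ?_, ?_⟩
  · obtain ⟨T, hT⟩ := List.exists_mem_of_length_pos (l := L) (by omega)
    refine Finset.card_pos.2 ⟨T, (hmem T).2 ⟨T, hT, subset_rfl, ?_⟩⟩
    nlinarith [(Nat.cast_nonneg T.card : (0 : ℝ) ≤ T.card)]
  · exact Finset.card_pos.1 (by exact_mod_cast hpos _ (hshapes k))
  · obtain ⟨T, hT, hST, hc⟩ := (hmem _).1 (hshapes k)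
    exact ((div_le_iff₀ (hpos _ (hshapes k))).2 ((hLK T hT).2 _ hST hc).1).trans_lt hθδ
  · obtain ⟨T, hT, hST, hc⟩ := (hmem _).1 (hshapes k)
    exact ((div_le_iff₀ (hpos _ (hshapes k))).2 ((hLK T hT).2 _ hST hc).2).trans_lt hθδ
  let F : Finset G := insert 1 (L.toFinset.biUnion fun T => T ∪ T⁻¹)
  have hLF : ∀ T ∈ L, T ∪ T⁻¹ ⊆ F := fun T hT =>
    (Finset.subset_biUnion_of_mem (fun T : Finset G => T ∪ T⁻¹) (List.mem_toFinset.2 hT)).trans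
      (Finset.subset_insert _ _)
  refine ⟨F, Finset.mem_insert_self _ _, η / 4, by positivity, ?_⟩
  rintro d σ ⟨B, hBcard, hB⟩ V hV
  have hσ : IsFreeOn σ F (V ∩ B) :=
    ⟨fun a ha => (hB a (Finset.mem_inter.1 ha).2).1,
      fun a ha => (hB a (Finset.mem_inter.1 ha).2).2.1,
      fun a ha => (hB a (Finset.mem_inter.1 ha).2).2.2⟩
  obtain ⟨P, hP, hPshape, hPcov⟩ := IsPacking.exists_iterated_extension (P := ∅) hσ hε0
    (by linarith) hθ0.le L hL
    (fun T hT => ⟨(hLK T hT).1, Finset.subset_union_left.trans (hLF T hT),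
      Finset.subset_union_right.trans (hLF T hT)⟩) ⟨by simp, by simp, by simp⟩ (by simp)
  let C : Fin shapes.card → Finset (Fin d) := fun k =>
    (P.filter fun p => p.1 = (e.symm k : Finset G)).image Prod.snd
  have hC : ∀ k c, c ∈ C k ↔ ((e.symm k : Finset G), c) ∈ P := by
    intro k c
    simp [C]
  refine ⟨C, fun k c hc => (Finset.mem_inter.1 (hP.centre _ ((hC k c).1 hc))).1,
    fun k => ?_, ?_, ?_⟩
  · rintro ⟨s, c⟩ hp ⟨s', c'⟩ hp' heq
    simp only [Finset.coe_product, Set.mem_prod, Finset.mem_coe] at hp hp' heq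
    have hcP := (hC k c).1 hp.2
    have hcP' := (hC k c').1 hp'.2
    obtain rfl : c = c' := by
      by_contra hne
      refine Finset.disjoint_left.1 (hP.disj _ hcP _ hcP' fun h => hne (Prod.ext_iff.1 h).2)
        (Finset.mem_image_of_mem _ hp.1) ?_
      rw [heq]
      exact Finset.mem_image_of_mem _ hp'.1
    by_contra hne
    exact hσ.inj c (hP.centre _ hcP) s (hP.shape _ hcP hp.1) s' (hP.shape _ hcP hp'.1)
      (fun h => hne (by rw [h])) heq
  · intro k _ k' _ hkk'
    simp only [Function.onFun, image_product_eq_biUnion_tile]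
    refine (Finset.disjoint_biUnion_left _ _ _).2 fun c hc =>
      (Finset.disjoint_biUnion_right _ _ _).2 fun c' hc' =>
        hP.disj _ ((hC k c).1 hc) _ ((hC k' c').1 hc') fun h => hkk' ?_
    exact e.symm.injective (Subtype.ext (Prod.ext_iff.1 h).1)
  · have hsub : covered σ P ⊆
        Finset.univ.biUnion fun k => (((e.symm k : Finset G) ×ˢ C k).image fun p => σ p.1 p.2) := by
      intro x hx
      obtain ⟨p, hp, s, hs, rfl⟩ := mem_covered.1 hx
      have hpS : p.1 ∈ shapes :=
        (hmem _).2 ((hPshape p hp).resolve_left (Finset.notMem_empty _))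
      refine Finset.mem_biUnion.2 ⟨e ⟨p.1, hpS⟩, Finset.mem_univ _,
        Finset.mem_image.2 ⟨(s, p.2), Finset.mem_product.2 ⟨by simpa using hs, ?_⟩, rfl⟩⟩
      rw [hC]
      simpa using hp
    refine le_trans ?_ (Nat.cast_le.2 (Finset.card_le_card hsub))
    have hd : (0 : ℝ) ≤ d := Nat.cast_nonneg d
    have hW : (V.card : ℝ) + B.card ≤ (V ∩ B).card + d := by
      have h1 := Finset.card_union_add_card_inter V B
      have h2 := (Finset.card_le_univ (V ∪ B)).trans_eq (Fintype.card_fin d)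
      have h3 : V.card + B.card ≤ (V ∩ B).card + d := by omega
      exact_mod_cast h3
    have hWd : ((V ∩ B).card : ℝ) ≤ d := by
      exact_mod_cast (Finset.card_le_univ _).trans_eq (Fintype.card_fin d)
    have hcov0 : ((covered σ (∅ : Finset (Finset G × Fin d))).card : ℝ) = 0 := by
      simp [covered]
    rw [hlen, hcov0] at hPcov
    have hdecay : (1 - ε) ^ (n + 1) * (((V ∩ B).card : ℝ) - 0 - θ * d) ≤ η / 4 * d :=
      (mul_le_mul_of_nonneg_left (by nlinarith) (pow_nonneg (by linarith) _)).trans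
        (mul_le_mul_of_nonneg_right hn' hd)
    nlinarith [mul_le_mul_of_nonneg_right hθη hd]

end Sofic
end
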